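/- Let u and v be adjacent vertices in a finite tree T, and let T' be obtained from T by the Kelmans operation from v to u (replacing every edge vw with w a neighbor of v other than u by the edge uw). Then the local mean subtree order satisfies μ(T'; v) ≥ μ(T; u), with equality if and only if u is a leaf of T or T is a path with v as a leaf. -/

import Mathlib

open Finset Polynomial

variable {V : Type*}

/-- The vertex sets of the subtrees of `G` that lie inside the set `S` and contain
the vertex `w` : nonempty connected induced subgraphs. -/
noncomputable def subtreesIn [Fintype V] [DecidableEq V] (G : SimpleGraph V) (S : Set V)
    (w : V) : Finset (Finset V) := by
  classical
  exact Finset.univ.filter fun A => w ∈ A ∧ (A : Set V) ⊆ S ∧ (G.induce (A : Set V)).Connected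

/-- The vertex sets of the subtrees of `G` containing `w`. -/
noncomputable def subtrees [Fintype V] [DecidableEq V] (G : SimpleGraph V) (w : V) :
    Finset (Finset V) := subtreesIn G Set.univ w

/-- The generating polynomial `φ_{T,w}` of subtrees of `G` inside `S` containing `w`,
counted by order. -/
noncomputable def subtreePolyIn [Fintype V] [DecidableEq V] (G : SimpleGraph V) (S : Set V)
    (w : V) : Polynomial ℝ := ∑ A ∈ subtreesIn G S w, X ^ A.card

/-- The generating polynomial `φ_{T,w}` of subtrees of `G` containing `w`. -/
noncomputable def subtreePoly [Fintype V] [DecidableEq V] (G : SimpleGraph V) (w : V) :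
    Polynomial ℝ := subtreePolyIn G Set.univ w

/-- The local mean subtree order `μ(G; w)`: the average order of subtrees of `G`
containing `w`. -/
noncomputable def meanOrder [Fintype V] [DecidableEq V] (G : SimpleGraph V) (w : V) : ℝ :=
  (∑ A ∈ subtrees G w, (A.card : ℝ)) / ((subtrees G w).card : ℝ)

/-- The vertex set of the connected component of `G - D` containing `w`. -/
def compDel (G : SimpleGraph V) (D : Set V) (w : V) : Set V :=
  {x | ∃ p : G.Walk w x, ∀ y ∈ p.support, y ∉ D}

/-- The neighbours of `u` as a `Finset`. -/
noncomputable def nbrFinset [Fintype V] (G : SimpleGraph V) (u : V) : Finset V := by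
  classical
  exact Finset.univ.filter fun w => G.Adj u w

/-- `G` is a path: a tree all of whose vertices have degree at most `2`. -/
def IsPathGraph [Fintype V] (G : SimpleGraph V) : Prop :=
  G.IsTree ∧ ∀ v : V, (G.neighborSet v).ncard ≤ 2

/-- The induced subgraph of `G` on `S` is a path (as a subgraph of a tree:
connected with all degrees within `S` at most `2`). -/
def IsPathOn (G : SimpleGraph V) (S : Set V) : Prop :=
  (G.induce S).Connected ∧ ∀ x ∈ S, (G.neighborSet x ∩ S).ncard ≤ 2

/-- The partial Kelmans operation on `G` from `v` to `u`, moving the edges between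
`v` and the set `W`: each edge `v w`, `w ∈ W`, is replaced by the edge `u w`. -/
def pkelmans (G : SimpleGraph V) (v u : V) (W : Set V) : SimpleGraph V :=
  SimpleGraph.fromRel fun a b =>
    (G.Adj a b ∧ ¬(a = v ∧ b ∈ W) ∧ ¬(b = v ∧ a ∈ W)) ∨
    (a = u ∧ b ∈ W ∧ G.Adj v b)

/-- The Kelmans operation on `G` from `v` to `u`: every edge `v w` with
`w ∈ N(v) \ {u}` is replaced by the edge `u w`. -/
def kelmans (G : SimpleGraph V) (v u : V) : SimpleGraph V :=
  pkelmans G v u (G.neighborSet v \ {u})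

/-- `A` contains `w`, and every set containing `w` and closed under adjacency within `A`
contains `A`. -/
def IsConnFrom (G : SimpleGraph V) (A : Finset V) (w : V) : Prop :=
  w ∈ A ∧ ∀ P : V → Prop, P w → (∀ a ∈ A, P a → ∀ b ∈ A, G.Adj a b → P b) → ∀ x ∈ A, P x

/-- The edge `u v` is the only edge of `G` between `S` and its complement. -/
def IsEdgeCut (G : SimpleGraph V) (S : Set V) (u v : V) : Prop :=
  u ∈ S ∧ v ∉ S ∧ G.Adj u v ∧ ∀ x ∈ S, ∀ y ∉ S, G.Adj x y → x = u ∧ y = v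

lemma mem_subtreesIn_iff [Fintype V] [DecidableEq V] {G : SimpleGraph V} {S : Set V} {w : V}
    {A : Finset V} : A ∈ subtreesIn G S w ↔ IsConnFrom G A w ∧ ∀ x ∈ A, x ∈ S := by
  classical
  simp only [subtreesIn, mem_filter, mem_univ, true_and]
  constructor
  · rintro ⟨hw, hS, hc⟩
    refine ⟨⟨hw, fun P hP hcl x hx => ?_⟩, fun x hx => hS hx⟩
    have h := hc.preconnected ⟨w, hw⟩ ⟨x, hx⟩
    rw [SimpleGraph.reachable_iff_reflTransGen] at h
    have key : ∀ y : (A : Set V),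
        Relation.ReflTransGen (G.induce (A : Set V)).Adj ⟨w, hw⟩ y → P y := by
      intro y hy
      induction hy with
      | refl => exact hP
      | tail _ hab ih => exact hcl _ (Subtype.prop _) ih _ (Subtype.prop _) hab
    exact key _ h
  · rintro ⟨⟨hw, h⟩, hS⟩
    refine ⟨hw, fun x hx => hS x hx, ?_⟩
    rw [SimpleGraph.connected_iff_exists_forall_reachable]
    refine ⟨⟨w, hw⟩, fun ⟨x, hx⟩ => ?_⟩
    obtain ⟨_, h'⟩ := h (fun x => ∃ hx : x ∈ (A : Set V),
      (G.induce (A : Set V)).Reachable ⟨w, hw⟩ ⟨x, hx⟩) ⟨hw, .refl _⟩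
      (fun a ha ⟨_, hr⟩ b hb hab => ⟨hb, hr.trans (SimpleGraph.Adj.reachable
        (G := G.induce (A : Set V)) (u := ⟨a, ha⟩) (v := ⟨b, hb⟩) hab)⟩) x hx
    exact h'

lemma mem_subtrees_iff [Fintype V] [DecidableEq V] {G : SimpleGraph V} {w : V}
    {A : Finset V} : A ∈ subtrees G w ↔ IsConnFrom G A w := by
  simp [subtrees, mem_subtreesIn_iff]

namespace IsConnFrom

variable {G : SimpleGraph V} {A B : Finset V} {w a b : V}

lemma singleton (w : V) : IsConnFrom G {w} w :=
  ⟨by simp, fun P hP _ x hx => by rwa [Finset.mem_singleton.1 hx]⟩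

lemma insert [DecidableEq V] (h : IsConnFrom G A w) (ha : a ∈ A) (hab : G.Adj a b) :
    IsConnFrom G (insert b A) w := by
  refine ⟨mem_insert_of_mem h.1, fun P hP hcl x hx => ?_⟩
  have hA := h.2 P hP fun a ha hPa b hb =>
    hcl a (mem_insert_of_mem ha) hPa b (mem_insert_of_mem hb)
  rcases mem_insert.1 hx with rfl | hx
  · exact hcl a (mem_insert_of_mem ha) (hA a ha) x (mem_insert_self _ _) hab
  · exact hA x hx

lemma exists_adj_of_not_subset (h : IsConnFrom G B w) (hw : w ∈ A) (hBA : ¬ B ⊆ A) :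
    ∃ a ∈ A, ∃ b ∈ B, b ∉ A ∧ G.Adj a b := by
  by_contra! hc
  exact hBA (h.2 (· ∈ A) hw fun a _ ha b hb hab => by_contra fun hbA => hc a ha b hb hbA hab)

/-- A connected set contains connected sets of all smaller positive orders. -/
lemma exists_subset_card [DecidableEq V] (h : IsConnFrom G B w) {k : ℕ} (hk : 1 ≤ k)
    (hkB : k ≤ B.card) : ∃ A ⊆ B, IsConnFrom G A w ∧ A.card = k := by
  induction k, hk using Nat.le_induction with
  | base => exact ⟨{w}, by simpa using h.1, singleton w, by simp⟩
  | succ k hk ih =>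
    obtain ⟨A, hAB, hA, hc⟩ := ih (by omega)
    obtain ⟨a, ha, b, hb, hbA, hab⟩ := h.exists_adj_of_not_subset hA.1
      (fun hBA => by have := card_le_card hBA; omega)
    exact ⟨Insert.insert b A, insert_subset hb hAB, hA.insert ha hab, by simp [hbA, hc]⟩

lemma univ [Fintype V] (hG : G.Connected) (w : V) : IsConnFrom G univ w := by
  refine ⟨mem_univ _, fun P hP hcl x hx => ?_⟩
  clear hx
  have h := hG.preconnected w x
  rw [SimpleGraph.reachable_iff_reflTransGen] at h
  induction h with
  | refl => exact hP
  | tail _ hab ih => exact hcl _ (mem_univ _) ih _ (mem_univ _) hab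

end IsConnFrom

/-- If the values of `f` on `s` are positive and leave no gaps, then their sum is at most
`1 + 2 + ⋯ + #s`, with equality exactly when `f` is injective on `s`. -/
lemma two_mul_sum_le_of_no_gaps {ι : Type*} [DecidableEq ι] (f : ι → ℕ) (s : Finset ι)
    (hgap : ∀ x ∈ s, ∀ k, 1 ≤ k → k ≤ f x → ∃ y ∈ s, f y = k) (hpos : ∀ x ∈ s, 1 ≤ f x) :
    2 * ∑ x ∈ s, f x ≤ s.card * (s.card + 1) ∧
      (2 * ∑ x ∈ s, f x = s.card * (s.card + 1) ↔ Set.InjOn f s) := by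
  induction s using Finset.induction_on_max_value f with
  | empty => simp
  | insert x s hxs hmax ih =>
    obtain ⟨ih₁, ih₂⟩ := ih
      (fun y hy k hk hky => by
        rcases eq_or_ne k (f y) with rfl | hne
        · exact ⟨y, hy, rfl⟩
        obtain ⟨z, hz, hzk⟩ := hgap y (mem_insert_of_mem hy) k hk hky
        rcases mem_insert.1 hz with rfl | hz
        · have := hmax y hy; omega
        · exact ⟨z, hz, hzk⟩) (fun y hy => hpos y (mem_insert_of_mem hy))
    have himg : (insert x s).image f = Icc 1 (f x) := by
      ext k
      simp only [mem_image, Finset.mem_Icc]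
      constructor
      · rintro ⟨y, hy, rfl⟩
        refine ⟨hpos y hy, ?_⟩
        rcases mem_insert.1 hy with rfl | hy
        · exact le_rfl
        · exact hmax y hy
      · rintro ⟨h1, h2⟩
        exact hgap x (mem_insert_self _ _) k h1 h2
    have hcard : ((insert x s).image f).card = f x := by simp [himg]
    have hle : f x ≤ s.card + 1 := by
      rw [← hcard, ← card_insert_of_notMem hxs]; exact card_image_le
    rw [sum_insert hxs, card_insert_of_notMem hxs]
    refine ⟨by nlinarith, fun h => ?_, fun h => ?_⟩
    · have : f x = s.card + 1 := by nlinarith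
      rw [← card_image_iff, hcard, card_insert_of_notMem hxs, this]
    · have h1 : f x = s.card + 1 := by
        rw [← hcard, card_image_of_injOn h, card_insert_of_notMem hxs]
      have h2 := ih₂.2 (h.mono (by simp))
      rw [h1]; linarith

section EdgeCut

variable {G : SimpleGraph V} {S : Set V} {u v : V}

lemma IsEdgeCut.symm (h : IsEdgeCut G S u v) : IsEdgeCut G Sᶜ v u := by
  obtain ⟨h1, h2, h3, h4⟩ := h
  refine ⟨h2, by simpa using h1, h3.symm, fun x hx y hy hxy => ?_⟩
  exact (h4 y (by simpa using hy) x hx hxy.symm).symm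

lemma SimpleGraph.IsAcyclic.exists_isEdgeCut (hG : G.IsAcyclic) (huv : G.Adj u v) :
    ∃ S, IsEdgeCut G S u v := by
  have hb := SimpleGraph.isAcyclic_iff_forall_adj_isBridge.1 hG huv
  rw [SimpleGraph.isBridge_iff] at hb
  refine ⟨{x | (G.deleteEdges {s(u, v)}).Reachable u x}, .refl _, hb, huv,
    fun x hx y hy hxy => ?_⟩
  by_cases he : s(x, y) = s(u, v)
  · rcases Sym2.eq_iff.1 he with h | ⟨rfl, rfl⟩
    · exact h
    · exact (hb hx).elim
  · refine (hy (SimpleGraph.Reachable.trans hx (SimpleGraph.Adj.reachable ?_))).elim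
    rw [SimpleGraph.deleteEdges_adj]
    exact ⟨hxy, he⟩

lemma IsEdgeCut.isConnFrom_inter (h : IsEdgeCut G S u v) [DecidablePred (· ∈ S)] {A : Finset V}
    (hA : IsConnFrom G A u) : IsConnFrom G (A.filter (· ∈ S)) u := by
  refine ⟨mem_filter.2 ⟨hA.1, h.1⟩, fun P hP hcl x hx => ?_⟩
  obtain ⟨hxA, hxS⟩ := mem_filter.1 hx
  refine hA.2 (fun y => y ∈ S → P y) (fun _ => hP) (fun a ha hPa b hb hab hbS => ?_) x hxA hxS
  by_cases haS : a ∈ S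
  · exact hcl a (mem_filter.2 ⟨ha, haS⟩) (hPa haS) b (mem_filter.2 ⟨hb, hbS⟩) hab
  · rw [(h.2.2.2 b hbS a haS hab.symm).1]
    exact hP

lemma IsConnFrom.of_mem {A : Finset V} (hA : IsConnFrom G A u) (hv : v ∈ A) :
    IsConnFrom G A v := by
  refine ⟨hv, fun P hP hcl => ?_⟩
  have hu : P u := by
    by_contra hu
    refine hA.2 (fun x => ¬ P x) hu (fun a ha hPa b hb hab hPb => ?_) v hv hP
    exact hPa (hcl b hb hPb a ha hab.symm)
  exact hA.2 P hu hcl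

lemma IsEdgeCut.forall_mem_of_notMem (h : IsEdgeCut G S u v) {A : Finset V}
    (hA : IsConnFrom G A u) (hv : v ∉ A) : ∀ x ∈ A, x ∈ S := by
  refine hA.2 (· ∈ S) h.1 fun a _ haS b hb hab => by_contra fun hbS => hv ?_
  rwa [← (h.2.2.2 a haS b hbS hab).2]

variable [DecidableEq V]

lemma IsEdgeCut.isConnFrom_union (h : IsEdgeCut G S u v) {A B : Finset V}
    (hA : IsConnFrom G A u) (hB : IsConnFrom G B v) : IsConnFrom G (A ∪ B) u := by
  refine ⟨mem_union_left _ hA.1, fun P hP hcl x hx => ?_⟩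
  have h1 := hA.2 P hP fun a ha hPa b hb =>
    hcl a (mem_union_left _ ha) hPa b (mem_union_left _ hb)
  have hv : P v := hcl u (mem_union_left _ hA.1) hP v (mem_union_right _ hB.1) h.2.2.1
  have h2 := hB.2 P hv fun a ha hPa b hb =>
    hcl a (mem_union_right _ ha) hPa b (mem_union_right _ hb)
  exact (mem_union.1 hx).elim (h1 x) (h2 x)

variable [Fintype V]

/-- The connected sets containing both ends of a cut edge are the unions of a connected set on
either side. -/
lemma IsEdgeCut.filter_mem_eq_image (h : IsEdgeCut G S u v) :
    (subtrees G u).filter (v ∈ ·) =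
      (subtreesIn G S u ×ˢ subtreesIn G Sᶜ v).image (fun p => p.1 ∪ p.2) := by
  classical
  ext A
  simp only [mem_filter, mem_image, mem_product, mem_subtrees_iff, mem_subtreesIn_iff, Prod.exists]
  constructor
  · rintro ⟨hA, hv⟩
    refine ⟨A.filter (· ∈ S), A.filter (· ∈ Sᶜ), ⟨⟨h.isConnFrom_inter hA, by simp⟩,
      ⟨h.symm.isConnFrom_inter (hA.of_mem hv), by simp⟩⟩, ?_⟩
    ext x
    simp only [mem_union, mem_filter, Set.mem_compl_iff]
    tauto
  · rintro ⟨B, C, ⟨⟨hB, -⟩, hC, -⟩, rfl⟩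
    exact ⟨h.isConnFrom_union hB hC, mem_union_right _ hC.1⟩

lemma disjoint_of_mem_subtreesIn {A B : Finset V} (hA : A ∈ subtreesIn G S u)
    (hB : B ∈ subtreesIn G Sᶜ v) : Disjoint A B :=
  disjoint_left.2 fun x hxA hxB =>
    (mem_subtreesIn_iff.1 hB).2 x hxB ((mem_subtreesIn_iff.1 hA).2 x hxA)

lemma injOn_union_subtreesIn :
    Set.InjOn (fun p : Finset V × Finset V => p.1 ∪ p.2)
      (subtreesIn G S u ×ˢ subtreesIn G Sᶜ v : Finset (Finset V × Finset V)) := by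
  rintro ⟨A, B⟩ hp ⟨C, D⟩ hq hpq
  simp only [Finset.coe_product, Set.mem_prod, Finset.mem_coe, mem_subtreesIn_iff] at hp hq
  simp only [Finset.ext_iff, mem_union] at hpq
  rw [Prod.mk.injEq, Finset.ext_iff, Finset.ext_iff]
  refine ⟨fun x => ?_, fun x => ?_⟩ <;>
  · have := hpq x
    have := hp.1.2 x
    have := hp.2.2 x
    have := hq.1.2 x
    have := hq.2.2 x
    simp only [Set.mem_compl_iff] at *
    tauto

lemma IsEdgeCut.card_filter_mem (h : IsEdgeCut G S u v) :
    ((subtrees G u).filter (v ∈ ·)).card =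
      (subtreesIn G S u).card * (subtreesIn G Sᶜ v).card := by
  rw [h.filter_mem_eq_image, card_image_of_injOn injOn_union_subtreesIn, card_product]

lemma IsEdgeCut.sum_card_filter_mem (h : IsEdgeCut G S u v) :
    ∑ A ∈ (subtrees G u).filter (v ∈ ·), A.card =
      (∑ A ∈ subtreesIn G S u, A.card) * (subtreesIn G Sᶜ v).card +
        (subtreesIn G S u).card * ∑ A ∈ subtreesIn G Sᶜ v, A.card := by
  rw [h.filter_mem_eq_image, sum_image injOn_union_subtreesIn,
    sum_congr rfl fun p hp => card_union_of_disjoint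
      (disjoint_of_mem_subtreesIn (mem_product.1 hp).1 (mem_product.1 hp).2),
    sum_product]
  simp only [sum_add_distrib, sum_const, smul_eq_mul, mul_comm, mul_sum]

lemma IsEdgeCut.filter_notMem (h : IsEdgeCut G S u v) :
    (subtrees G u).filter (v ∉ ·) = subtreesIn G S u := by
  ext A
  simp only [mem_filter, mem_subtrees_iff, mem_subtreesIn_iff]
  exact ⟨fun ⟨hA, hv⟩ => ⟨hA, h.forall_mem_of_notMem hA hv⟩,
    fun ⟨hA, hS⟩ => ⟨hA, fun hv => h.2.1 (hS v hv)⟩⟩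

lemma IsEdgeCut.singleton_mem_subtreesIn (h : IsEdgeCut G S u v) : {u} ∈ subtreesIn G S u :=
  mem_subtreesIn_iff.2 ⟨.singleton u, by simpa using h.1⟩

lemma IsEdgeCut.card_subtreesIn_pos (h : IsEdgeCut G S u v) : 1 ≤ (subtreesIn G S u).card :=
  card_pos.2 ⟨_, h.singleton_mem_subtreesIn⟩

lemma IsEdgeCut.ncard_neighborSet_eq_one_iff (h : IsEdgeCut G S u v) :
    (G.neighborSet u).ncard = 1 ↔ subtreesIn G S u = {{u}} := by
  rw [Set.ncard_eq_one]
  constructor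
  · rintro ⟨w, hw⟩
    obtain rfl : v = w := by
      have : v ∈ G.neighborSet u := h.2.2.1
      rwa [hw] at this
    refine eq_singleton_iff_unique_mem.2 ⟨h.singleton_mem_subtreesIn, fun A hA => ?_⟩
    obtain ⟨hA, hS⟩ := mem_subtreesIn_iff.1 hA
    by_contra hne
    obtain ⟨a, ha, b, hb, -, hab⟩ := hA.exists_adj_of_not_subset (mem_singleton_self u)
      (fun hsub => hne (hsub.antisymm (singleton_subset_iff.2 hA.1)))
    rw [Finset.mem_singleton] at ha
    subst ha
    have hb' : b ∈ G.neighborSet a := hab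
    rw [hw, Set.mem_singleton_iff] at hb'
    exact h.2.1 (hb' ▸ hS b hb)
  · intro hF
    refine ⟨v, Set.eq_singleton_iff_unique_mem.2 ⟨h.2.2.1, fun w hw => ?_⟩⟩
    by_contra hne
    have hwS : w ∈ S := by_contra fun hwS => hne (h.2.2.2 u h.1 w hwS hw).2
    have hmem : insert w {u} ∈ subtreesIn G S u :=
      mem_subtreesIn_iff.2 ⟨(IsConnFrom.singleton u).insert (mem_singleton_self u) hw, by
        simp [hwS, h.1]⟩
    rw [hF, Finset.mem_singleton] at hmem
    have : w ∈ ({u} : Finset V) := hmem ▸ mem_insert_self _ _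
    exact hw.ne (Finset.mem_singleton.1 this).symm

lemma IsEdgeCut.card_subtreesIn_eq_one_iff (h : IsEdgeCut G S u v) :
    (subtreesIn G S u).card = 1 ↔ (G.neighborSet u).ncard = 1 := by
  rw [h.ncard_neighborSet_eq_one_iff, card_eq_one]
  refine ⟨fun ⟨A, hA⟩ => ?_, fun hF => ⟨_, hF⟩⟩
  have := h.singleton_mem_subtreesIn
  rw [hA, Finset.mem_singleton] at this
  rw [hA, this]

lemma two_mul_sum_card_subtreesIn_le :
    2 * ∑ A ∈ subtreesIn G S u, A.card ≤
        (subtreesIn G S u).card * ((subtreesIn G S u).card + 1) ∧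
      (2 * ∑ A ∈ subtreesIn G S u, A.card =
          (subtreesIn G S u).card * ((subtreesIn G S u).card + 1) ↔
        Set.InjOn Finset.card (subtreesIn G S u : Set (Finset V))) := by
  refine two_mul_sum_le_of_no_gaps _ _ (fun A hA k hk hkA => ?_) (fun A hA => ?_)
  · obtain ⟨hA, hS⟩ := mem_subtreesIn_iff.1 hA
    obtain ⟨B, hBA, hB, hc⟩ := hA.exists_subset_card hk hkA
    exact ⟨B, mem_subtreesIn_iff.2 ⟨hB, fun x hx => hS x (hBA hx)⟩, hc⟩
  · exact card_pos.2 ⟨u, (mem_subtreesIn_iff.1 hA).1.1⟩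

lemma card_le_sum_card_subtreesIn :
    (subtreesIn G S u).card ≤ ∑ A ∈ subtreesIn G S u, A.card := by
  rw [card_eq_sum_ones]
  exact sum_le_sum fun A hA => card_pos.2 ⟨u, (mem_subtreesIn_iff.1 hA).1.1⟩

end EdgeCut

lemma kelmans_adj {G : SimpleGraph V} {u v : V} (a b : V) :
    (kelmans G v u).Adj a b ↔ a ≠ b ∧
      ((G.Adj a b ∧ (a = v → b = u) ∧ (b = v → a = u)) ∨
        (a = u ∧ b ≠ u ∧ G.Adj v b) ∨ (b = u ∧ a ≠ u ∧ G.Adj v a)) := by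
  simp only [kelmans, pkelmans, SimpleGraph.fromRel_adj, Set.mem_sdiff,
    SimpleGraph.mem_neighborSet, Set.mem_singleton_iff]
  grind [SimpleGraph.adj_comm]

lemma isConnFrom_kelmans_iff {G : SimpleGraph V} {u v : V} (huv : G.Adj u v) {A : Finset V}
    (hu : u ∈ A) (hv : v ∈ A) : IsConnFrom (kelmans G v u) A u ↔ IsConnFrom G A u := by
  have hK : (kelmans G v u).Adj u v := by
    rw [kelmans_adj]
    exact ⟨huv.ne, .inl ⟨huv, fun h => h.symm, fun _ => rfl⟩⟩
  constructor
  · rintro ⟨-, h⟩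
    refine ⟨hu, fun P hP hcl => ?_⟩
    have hPv := hcl u hu hP v hv huv
    refine h P hP fun a ha hPa b hb hab => ?_
    rcases ((kelmans_adj a b).1 hab).2 with ⟨h', -⟩ | ⟨-, -, h'⟩ | ⟨rfl, -⟩
    · exact hcl a ha hPa b hb h'
    · exact hcl v hv hPv b hb h'
    · exact hP
  · rintro ⟨-, h⟩
    refine ⟨hu, fun P hP hcl => ?_⟩
    have hPv := hcl u hu hP v hv hK
    refine h P hP fun a ha hPa b hb hab => ?_
    by_cases hbu : b = u
    · rwa [hbu]
    by_cases hbv : b = v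
    · rwa [hbv]
    by_cases hav : a = v
    · subst hav
      exact hcl u hu hP b hb
        ((kelmans_adj u b).2 ⟨fun h => hbu h.symm, .inr (.inl ⟨rfl, hbu, hab⟩)⟩)
    · exact hcl a ha hPa b hb ((kelmans_adj a b).2
        ⟨hab.ne, .inl ⟨hab, fun h => (hav h).elim, fun h => (hbv h).elim⟩⟩)

lemma subtrees_kelmans [Fintype V] [DecidableEq V] {G : SimpleGraph V} {u v : V}
    (huv : G.Adj u v) :
    subtrees (kelmans G v u) v = insert {v} ((subtrees G u).filter (v ∈ ·)) := by
  ext A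
  simp only [mem_insert, mem_filter, mem_subtrees_iff]
  constructor
  · intro hA
    by_cases hu : u ∈ A
    · exact .inr ⟨(isConnFrom_kelmans_iff huv hu hA.1).1 (hA.of_mem hu), hA.1⟩
    · left
      by_contra hne
      obtain ⟨a, ha, b, hb, hb', hab⟩ := hA.exists_adj_of_not_subset (mem_singleton_self v)
        (fun hsub => hne (hsub.antisymm (singleton_subset_iff.2 hA.1)))
      rw [Finset.mem_singleton] at ha
      subst ha
      rcases ((kelmans_adj _ _).1 hab).2 with ⟨-, h', -⟩ | ⟨h', -⟩ | ⟨h', -⟩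
      · exact hu (h' rfl ▸ hb)
      · exact huv.ne h'.symm
      · exact hu (h' ▸ hb)
  · rintro (rfl | ⟨hA, hv⟩)
    · exact .singleton v
    · exact ((isConnFrom_kelmans_iff huv hA.1 hv).2 hA).of_mem hv

section Path

variable {G : SimpleGraph V}

lemma SimpleGraph.IsAcyclic.eq_of_adj_of_isConnFrom (hG : G.IsAcyclic) {A : Finset V}
    {v x y z : V} (hA : IsConnFrom G A v) (hx : x ∉ A) (hy : y ∈ A) (hz : z ∈ A)
    (hxy : G.Adj x y) (hxz : G.Adj x z) : y = z := by
  obtain ⟨S, hS⟩ := hG.exists_isEdgeCut hxy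
  by_contra hne
  have hzS : z ∈ S := by_contra fun hzS => hne (hS.2.2.2 x hS.1 z hzS hxz).2.symm
  exact hS.symm.forall_mem_of_notMem (hA.of_mem hy) hx z hz hzS

lemma SimpleGraph.Connected.exists_adj_dist_add_one (hG : G.Connected) {v y : V} (hne : v ≠ y) :
    ∃ x, G.Adj x y ∧ G.dist v x + 1 = G.dist v y := by
  obtain ⟨p, hp⟩ := hG.exists_walk_length_eq_dist y v
  rw [SimpleGraph.dist_comm] at hp
  cases p with
  | nil => exact (hne rfl).elim
  | @cons _ x _ hyx q =>
    refine ⟨x, hyx.symm, ?_⟩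
    have h1 := SimpleGraph.dist_le q
    have h2 := hG.dist_triangle (u := v) (v := x) (w := y)
    rw [SimpleGraph.dist_eq_one_iff_adj.2 hyx.symm] at h2
    rw [SimpleGraph.dist_comm] at h1
    rw [SimpleGraph.Walk.length_cons] at hp
    omega

variable [Fintype V]

lemma SimpleGraph.Connected.dist_injective_of_ncard_neighborSet_le_two (hG : G.Connected) {v : V}
    (hdeg : ∀ x, (G.neighborSet x).ncard ≤ 2) (hv : (G.neighborSet v).ncard ≤ 1) :
    Function.Injective (G.dist v) := by
  suffices H : ∀ d y z, G.dist v y = d → G.dist v z = d → y = z from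
    fun y z h => H _ y z rfl h.symm
  intro d
  induction d with
  | zero =>
    intro y z hy hz
    rw [hG.dist_eq_zero_iff] at hy hz
    exact hy.symm.trans hz
  | succ d ih =>
    intro y z hy hz
    have hpos : ∀ y, G.dist v y = d + 1 → v ≠ y := by
      rintro _ h rfl; simp at h
    obtain ⟨x, hxy, hx⟩ := hG.exists_adj_dist_add_one (hpos y hy)
    obtain ⟨x', hxz, hx'⟩ := hG.exists_adj_dist_add_one (hpos z hz)
    obtain rfl := ih x x' (by omega) (by omega)
    by_cases hvx : v = x
    · subst hvx
      exact (Set.ncard_le_one (Set.toFinite _)).1 hv y hxy z hxz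
    · obtain ⟨w, hwx, hw⟩ := hG.exists_adj_dist_add_one hvx
      by_contra hyz
      have : 2 < (G.neighborSet x).ncard := by
        rw [Set.two_lt_ncard_iff (Set.toFinite _)]
        refine ⟨w, y, z, hwx.symm, hxy, hxz, ?_, ?_, hyz⟩ <;>
        · rintro rfl
          omega
      exact absurd (hdeg x) (by omega)

variable [DecidableEq V]

/-- If a tree has at most one subtree of each order at `v`, then every vertex other than `v` has
degree at most two. -/
lemma ncard_neighborSet_le_two_of_injOn (hG : G.IsTree) {v x : V}
    (h : Set.InjOn Finset.card (subtrees G v : Set (Finset V))) (hx : x ≠ v) :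
    (G.neighborSet x).ncard ≤ 2 := by
  obtain ⟨A, hA, hmax⟩ := ((subtrees G v).filter (x ∉ ·)).exists_max_image Finset.card
    ⟨{v}, mem_filter.2 ⟨mem_subtrees_iff.2 (.singleton v), by simpa using hx⟩⟩
  obtain ⟨hA, hxA⟩ := mem_filter.1 hA
  rw [mem_subtrees_iff] at hA
  obtain ⟨a, ha, b, -, hb, hab⟩ := (IsConnFrom.univ hG.connected v).exists_adj_of_not_subset hA.1
    (fun hsub => hxA (hsub (mem_univ x)))
  obtain rfl : x = b := by
    by_contra hne
    have := hmax (insert b A)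
      (mem_filter.2 ⟨mem_subtrees_iff.2 (hA.insert ha hab), by simp [hne, hxA]⟩)
    rw [card_insert_of_notMem hb] at this
    omega
  have hA' := hA.insert ha hab
  have h1 : (G.neighborSet x ∩ A).ncard ≤ 1 := by
    rw [Set.ncard_le_one (Set.toFinite _)]
    rintro y ⟨hy, hyA⟩ z ⟨hz, hzA⟩
    exact hG.isAcyclic.eq_of_adj_of_isConnFrom hA hxA hyA hzA hy hz
  have h2 : (G.neighborSet x \ A).ncard ≤ 1 := by
    rw [Set.ncard_le_one (Set.toFinite _)]
    rintro y ⟨hy, hyA⟩ z ⟨hz, hzA⟩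
    rw [Finset.mem_coe] at hyA hzA
    have hy' : y ∉ insert x A := by simp [hyA, (SimpleGraph.Adj.ne' hy : y ≠ x)]
    have hz' : z ∉ insert x A := by simp [hzA, (SimpleGraph.Adj.ne' hz : z ≠ x)]
    have heq := h (mem_subtrees_iff.2 (hA'.insert (mem_insert_self x A) hy))
      (mem_subtrees_iff.2 (hA'.insert (mem_insert_self x A) hz))
      (by rw [card_insert_of_notMem hy', card_insert_of_notMem hz'])
    have hyz : y ∈ insert z (insert x A) := heq ▸ mem_insert_self _ _
    exact (mem_insert.1 hyz).resolve_right hy'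
  have := Set.ncard_union_le (G.neighborSet x ∩ A) (G.neighborSet x \ A)
  rw [Set.inter_union_sdiff] at this
  omega

lemma injOn_card_subtrees_of_dist_injective (hG : G.Connected) {v : V}
    (h : Function.Injective (G.dist v)) :
    Set.InjOn Finset.card (subtrees G v : Set (Finset V)) := by
  have hdown : ∀ A, IsConnFrom G A v → ∀ x ∈ A, ∀ z, G.dist v z ≤ G.dist v x → z ∈ A := by
    intro A hA
    refine hA.2 _ (fun z hz => ?_) (fun a ha hPa b hb hab z hz => ?_)
    · rw [SimpleGraph.dist_self, Nat.le_zero, hG.dist_eq_zero_iff] at hz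
      exact hz ▸ hA.1
    · have h2 := hG.dist_triangle (u := v) (v := a) (w := b)
      rw [SimpleGraph.dist_eq_one_iff_adj.2 hab] at h2
      by_cases hle : G.dist v z ≤ G.dist v a
      · exact hPa z hle
      · rwa [h (show G.dist v z = G.dist v b by omega)]
  intro A hA B hB hAB
  rw [Finset.mem_coe, mem_subtrees_iff] at hA hB
  by_cases hsub : A ⊆ B
  · exact eq_of_subset_of_card_le hsub hAB.ge
  · obtain ⟨x, hxA, hxB⟩ := not_subset.1 hsub
    refine (eq_of_subset_of_card_le (fun y hy => ?_) hAB.le).symm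
    rcases le_total (G.dist v y) (G.dist v x) with hle | hle
    · exact hdown A hA x hxA y hle
    · exact (hxB (hdown B hB y hy x hle)).elim

lemma IsEdgeCut.injOn_card_subtreesIn_iff {S : Set V} {u v : V} (h : IsEdgeCut G S u v)
    (hv : subtreesIn G Sᶜ v = {{v}}) :
    Set.InjOn Finset.card (subtreesIn G S u : Set (Finset V)) ↔
      Set.InjOn Finset.card (subtrees G v : Set (Finset V)) := by
  have hins : ∀ A ∈ subtreesIn G S u, insert v A ∈ subtrees G v ∧ v ∉ A := by
    intro A hA
    obtain ⟨hA, hS⟩ := mem_subtreesIn_iff.1 hA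
    exact ⟨mem_subtrees_iff.2 ((hA.insert hA.1 h.2.2.1).of_mem (mem_insert_self _ _)),
      fun hvA => h.2.1 (hS v hvA)⟩
  have hdec : ∀ A ∈ subtrees G v, A = {v} ∨ ∃ B ∈ subtreesIn G S u, A = insert v B := by
    intro A hA
    by_cases hu : u ∈ A
    · right
      have : A ∈ (subtrees G u).filter (v ∈ ·) := by
        rw [mem_subtrees_iff] at hA
        exact mem_filter.2 ⟨mem_subtrees_iff.2 (hA.of_mem hu), hA.1⟩
      rw [h.filter_mem_eq_image, hv, mem_image] at this
      obtain ⟨⟨B, C⟩, hBC, rfl⟩ := this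
      rw [mem_product, Finset.mem_singleton] at hBC
      obtain ⟨hB, hC⟩ := hBC
      dsimp only at hB hC
      exact ⟨B, hB, by rw [hC, Finset.union_comm, Finset.insert_eq]⟩
    · left
      have : A ∈ subtreesIn G Sᶜ v := by
        rw [← h.symm.filter_notMem]
        exact mem_filter.2 ⟨hA, hu⟩
      rwa [hv, Finset.mem_singleton] at this
  constructor
  · intro hinj A hA B hB hAB
    have hpos : ∀ C ∈ subtreesIn G S u, 0 < C.card := fun C hC =>
      card_pos.2 ⟨u, (mem_subtreesIn_iff.1 hC).1.1⟩
    rcases hdec A hA with rfl | ⟨A, hA', rfl⟩ <;> rcases hdec B hB with rfl | ⟨B, hB', rfl⟩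
    · rfl
    · rw [card_insert_of_notMem (hins B hB').2, card_singleton] at hAB
      have := hpos B hB'
      omega
    · rw [card_insert_of_notMem (hins A hA').2, card_singleton] at hAB
      have := hpos A hA'
      omega
    · rw [card_insert_of_notMem (hins A hA').2, card_insert_of_notMem (hins B hB').2] at hAB
      rw [hinj hA' hB' (by omega)]
  · intro hinj A hA B hB hAB
    have heq := hinj (hins A hA).1 (hins B hB).1
      (by rw [card_insert_of_notMem (hins A hA).2, card_insert_of_notMem (hins B hB).2, hAB])
    rw [← erase_insert (hins A hA).2, heq, erase_insert (hins B hB).2]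

lemma IsEdgeCut.injOn_card_subtreesIn_iff_isPathGraph (hG : G.IsTree) {S : Set V} {u v : V}
    (h : IsEdgeCut G S u v) (hv : (G.neighborSet v).ncard = 1) :
    Set.InjOn Finset.card (subtreesIn G S u : Set (Finset V)) ↔ IsPathGraph G := by
  rw [h.injOn_card_subtreesIn_iff (h.symm.ncard_neighborSet_eq_one_iff.1 hv)]
  constructor
  · refine fun hinj => ⟨hG, fun x => ?_⟩
    by_cases hx : x = v
    · rw [hx]; omega
    · exact ncard_neighborSet_le_two_of_injOn hG hinj hx
  · exact fun hP => injOn_card_subtrees_of_dist_injective hG.connected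
      (hG.connected.dist_injective_of_ncard_neighborSet_le_two hP.2 hv.le)

end Path

/-- The comparison of the two means, in terms of the numbers `a`, `b` of subtrees on the two
sides of the edge and their total orders `a'`, `b'`. -/
lemma mean_comparison {a b a' b' : ℕ} (ha : 1 ≤ a) (hb : 1 ≤ b) (haa' : a ≤ a')
    (ha' : 2 * a' ≤ a * (a + 1)) (hb' : b ≤ b') (hb1 : b = 1 → b' = 1) :
    ((a' + (a' * b + a * b') : ℕ) : ℝ) / ((a + a * b : ℕ) : ℝ) ≤
        ((1 + (a' * b + a * b') : ℕ) : ℝ) / ((1 + a * b : ℕ) : ℝ) ∧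
      (((1 + (a' * b + a * b') : ℕ) : ℝ) / ((1 + a * b : ℕ) : ℝ) =
          ((a' + (a' * b + a * b') : ℕ) : ℝ) / ((a + a * b : ℕ) : ℝ) ↔
        a = 1 ∨ (2 * a' = a * (a + 1) ∧ b = 1)) := by
  have h1 : (0 : ℝ) < ((a + a * b : ℕ) : ℝ) := by exact_mod_cast (by positivity)
  have h2 : (0 : ℝ) < ((1 + a * b : ℕ) : ℝ) := by exact_mod_cast (by positivity)
  rw [div_le_div_iff₀ h1 h2, div_eq_div_iff h2.ne' h1.ne']
  norm_cast
  obtain ⟨a, rfl⟩ := Nat.exists_eq_add_of_le' ha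
  obtain ⟨b, rfl⟩ := Nat.exists_eq_add_of_le' hb
  obtain ⟨c, rfl⟩ := Nat.exists_eq_add_of_le haa'
  obtain ⟨d, rfl⟩ := Nat.exists_eq_add_of_le hb'
  have hc : 2 * c ≤ (a + 1) * a := by nlinarith
  have key : 2 * ((1 + ((a + 1 + c) * (b + 1) + (a + 1) * (b + 1 + d))) *
        (a + 1 + (a + 1) * (b + 1))) =
      2 * ((a + 1 + c + ((a + 1 + c) * (b + 1) + (a + 1) * (b + 1 + d))) *
        (1 + (a + 1) * (b + 1))) +
      (((a + 1) * a - 2 * c) * (b + 2) + (a + 1) * a * (b + 2 * d)) := by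
    zify [hc]
    ring
  refine ⟨by omega, ?_⟩
  have hzero : (1 + ((a + 1 + c) * (b + 1) + (a + 1) * (b + 1 + d))) *
        (a + 1 + (a + 1) * (b + 1)) =
      (a + 1 + c + ((a + 1 + c) * (b + 1) + (a + 1) * (b + 1 + d))) *
        (1 + (a + 1) * (b + 1)) ↔
      ((a + 1) * a - 2 * c) * (b + 2) + (a + 1) * a * (b + 2 * d) = 0 := by omega
  rw [hzero]
  have hd : b = 0 → d = 0 := fun h => by have := hb1 (by omega); omega
  have hac : 2 * (a + 1 + c) = (a + 1) * (a + 1 + 1) ↔ (a + 1) * a - 2 * c = 0 := by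
    have : (a + 1) * (a + 1 + 1) = (a + 1) * a + 2 * (a + 1) := by ring
    omega
  rw [hac]
  simp only [Nat.add_eq_zero_iff, mul_eq_zero]
  constructor
  · rintro ⟨h3, h4⟩
    omega
  · rintro (h3 | ⟨h3, h4⟩)
    · have : a = 0 := by omega
      subst this
      omega
    · have := hd (by omega)
      omega

/-- For adjacent vertices `u, v` of a tree `T` and `T' = T_{(v→u)}` the
Kelmans operation from `v` to `u`: `μ(T'; v) ≥ μ(T; u)`, with equality iff `u` is a leaf
of `T` or `T` is a path with `v` as a leaf. -/
theorem kelmans_meanOrder_ge {V : Type*} [Fintype V] [DecidableEq V]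
    (G : SimpleGraph V) (hG : G.IsTree) (u v : V) (huv : G.Adj u v) :
    meanOrder (kelmans G v u) v ≥ meanOrder G u ∧
      (meanOrder (kelmans G v u) v = meanOrder G u ↔
        (G.neighborSet u).ncard = 1 ∨ (IsPathGraph G ∧ (G.neighborSet v).ncard = 1)) := by
  obtain ⟨S, h⟩ := hG.isAcyclic.exists_isEdgeCut huv
  have hnum := sum_filter_not_add_sum_filter (subtrees G u) (v ∈ ·) (fun A => A.card)
  have hden := card_filter_add_card_filter_not (s := subtrees G u) (v ∉ ·)
  simp only [not_not] at hden
  rw [h.filter_notMem, h.sum_card_filter_mem] at hnum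
  rw [h.filter_notMem, h.card_filter_mem] at hden
  have hv : {v} ∉ (subtrees G u).filter (v ∈ ·) := fun hmem =>
    huv.ne (Finset.mem_singleton.1 (mem_subtrees_iff.1 (mem_filter.1 hmem).1).1)
  have hb1 : (subtreesIn G Sᶜ v).card = 1 → ∑ A ∈ subtreesIn G Sᶜ v, A.card = 1 := fun hc => by
    rw [h.symm.ncard_neighborSet_eq_one_iff.1 (h.symm.card_subtreesIn_eq_one_iff.1 hc)]
    simp
  obtain ⟨hle, heq⟩ := mean_comparison h.card_subtreesIn_pos h.symm.card_subtreesIn_pos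
    card_le_sum_card_subtreesIn two_mul_sum_card_subtreesIn_le.1 card_le_sum_card_subtreesIn hb1
  simp only [meanOrder, ← Nat.cast_sum]
  rw [subtrees_kelmans huv, sum_insert hv, card_insert_of_notMem hv, h.card_filter_mem,
    h.sum_card_filter_mem, card_singleton, ← hnum, ← hden,
    Nat.add_comm ((subtreesIn G S u).card * (subtreesIn G Sᶜ v).card) 1]
  refine ⟨hle, heq.trans ?_⟩
  rw [h.card_subtreesIn_eq_one_iff, h.symm.card_subtreesIn_eq_one_iff,
    two_mul_sum_card_subtreesIn_le.2]
  exact or_congr_right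
    (and_congr_left fun hv => h.injOn_card_subtreesIn_iff_isPathGraph hG hv)
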